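/- arXiv:2201.05813 — 3 statements merged into one kernel-verified Lean document; each statement's English description precedes it below -/
import Mathlib

section
/- Let R = R_1 × … × R_ℓ be a product of finite local rings with Jacobson radical J, let σ : R^n → ℕ^u be a modular support, and let 0 ≠ C ⊆ R^n be an R-linear code such that either C ⊆ 0:_{R^n} J or each R_j is a finite chain ring. Then for all r ∈ {1,…,M(C)}, min wt(C) + r − 1 ≤ d_r(C) ≤ |σ(0:_{R^n} J)| − M(C) + r. In particular, min wt(C) ≤ |σ(0:_{R^n} J)| − M(C) + 1 (a Singleton-type bound). -/
/-- Least cardinality of a system of generators of a submodule (`μ`), with `μ(0)=0`. -/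
noncomputable def mu (R : Type*) {M : Type*} [Semiring R] [AddCommMonoid M] [Module R M]
    (D : Submodule R M) : ℕ :=
  sInf {k | ∃ s : Finset M, s.card = k ∧ Submodule.span R (s : Set M) = D}

/-- `G` is a minimal system of generators of the submodule `D`. -/
def IsMinGenSet (R : Type*) {M : Type*} [Semiring R] [AddCommMonoid M] [Module R M]
    (G : Set M) (D : Submodule R M) : Prop :=
  Submodule.span R G = D ∧ ∀ G' ⊆ G, Submodule.span R G' = D → G' = G

/-- The socle `0 :_C J`, where `J` is the Jacobson radical of `R`. -/
noncomputable def socJ {R M : Type*} [CommRing R] [AddCommGroup M] [Module R M]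
    (C : Submodule R M) : Submodule R M :=
  C ⊓ ⨅ r ∈ (⊥ : Ideal R).jacobson, LinearMap.ker (LinearMap.lsmul R M r)

/-- `D ∈ 𝒮_j(C)`: `D` is a subcode of `C` having a minimal system of generators of card `j`. -/
def memS {R M : Type*} [Semiring R] [AddCommMonoid M] [Module R M]
    (j : ℕ) (C D : Submodule R M) : Prop :=
  D ≤ C ∧ ∃ G : Finset M, G.card = j ∧ IsMinGenSet R (↑G : Set M) D

/-- The (componentwise) support of a set of vectors. -/
noncomputable def suppOf {M : Type*} {u : ℕ} (σ : M → Fin u → ℕ) (D : Set M) : Fin u → ℕ :=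
  fun i => sSup ((fun v => σ v i) '' D)

/-- The `r`-th generalized weight `d_r(C)`. -/
noncomputable def dGW {R M : Type*} [Semiring R] [AddCommMonoid M] [Module R M] {u : ℕ}
    (σ : M → Fin u → ℕ) (r : ℕ) (C : Submodule R M) : ℕ :=
  sInf {w | ∃ j, r ≤ j ∧ ∃ D : Submodule R M, memS j C D ∧ w = ∑ i, suppOf σ (D : Set M) i}

/-- `σ` is a support on `R^n`: (P1), (P2), (P3). -/
def IsSupport {R : Type*} [CommRing R] {n u : ℕ} (σ : (Fin n → R) → Fin u → ℕ) : Prop :=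
  (∀ v, σ v = 0 ↔ v = 0) ∧ (∀ (r : R) (v), σ (r • v) ≤ σ v) ∧ (∀ v w, σ (v + w) ≤ σ v ⊔ σ w)

/-- `σ` is modular: property (P⋆). -/
def IsModular {R : Type*} [CommRing R] {n u : ℕ} (σ : (Fin n → R) → Fin u → ℕ) : Prop :=
  ∀ v w (i : Fin u), σ v i ≠ 0 → σ v i ≤ σ w i → ∃ r : R, σ (v + r • w) i < σ v i

/-- The set of minimal (support) elements of a set `S` w.r.t. `σ`. -/
def MinSet {M : Type*} [Zero M] {u : ℕ} (σ : M → Fin u → ℕ) (S : Set M) : Set M :=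
  {v | v ∈ S ∧ v ≠ 0 ∧ ∀ w ∈ S, w ≠ 0 → σ w ≤ σ v → σ w = σ v}

/-- The `j`-th projected code `C_j ⊆ R_j^n`. -/
noncomputable def projCode {ℓ n : ℕ} {Rj : Fin ℓ → Type*} [∀ j, CommRing (Rj j)]
    (C : Submodule (∀ j, Rj j) (Fin n → ∀ j, Rj j)) (j : Fin ℓ) :
    Submodule (Rj j) (Fin n → Rj j) :=
  Submodule.span (Rj j) {w | ∃ v ∈ C, w = fun i => v i j}

/-- `M(C) = μ(C_1) + ⋯ + μ(C_ℓ)`. -/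
noncomputable def Mnum {ℓ n : ℕ} {Rj : Fin ℓ → Type*} [∀ j, CommRing (Rj j)]
    (C : Submodule (∀ j, Rj j) (Fin n → ∀ j, Rj j)) : ℕ :=
  ∑ j, mu (Rj j) (projCode C j)


noncomputable def len17 (R : Type*) {M : Type*} [CommRing R] [AddCommGroup M] [Module R M]
    (N : Submodule R M) : ℕ := (Module.length R N).toNat

section general
variable {R M : Type*} [CommRing R] [AddCommGroup M] [Module R M] [Finite M]

theorem len17_coe (N : Submodule R M) : (len17 R N : ℕ∞) = Module.length R N := by
  have : IsArtinian R M := inferInstance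
  have : IsNoetherian R M := inferInstance
  exact ENat.natCast_toNat Module.length_ne_top

theorem len17_bot : len17 R (⊥ : Submodule R M) = 0 := by
  simp [len17]

theorem len17_lt {N N' : Submodule R M} (h : N' < N) : len17 R N' < len17 R N := by
  have h1 := Submodule.height_strictMono (R := R) (M := M) h
  rw [← Module.length_submodule, ← Module.length_submodule, ← len17_coe, ← len17_coe] at h1
  exact_mod_cast h1

theorem len17_covBy {N N' : Submodule R M} (h : N' ⋖ N) : len17 R N = len17 R N' + 1 := by
  have h1 := (covBy_iff_quot_is_simple h.le).1 h
  have h2 := Module.length_eq_add_of_exact (N'.submoduleOf N).subtype (N'.submoduleOf N).mkQ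
    (Submodule.subtype_injective _) (Submodule.mkQ_surjective _)
    (by exact LinearMap.exact_subtype_mkQ _)
  rw [(Submodule.submoduleOfEquivOfLe h.le).length_eq] at h2
  have h3 : Module.length R (N ⧸ N'.submoduleOf N) = 1 := Module.length_eq_one_iff.2 h1
  rw [h3, ← len17_coe, ← len17_coe] at h2
  exact_mod_cast h2

theorem len17_map (C : Submodule R M) (f : M →ₗ[R] M) :
    len17 R C = len17 R (C ⊓ LinearMap.ker f) + len17 R (C.map f) := by
  have h2 := Module.length_eq_add_of_exact (LinearMap.ker (f.submoduleMap C)).subtype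
    (f.submoduleMap C)
    (Submodule.subtype_injective _) (LinearMap.submoduleMap_surjective f C)
    (LinearMap.exact_subtype_ker_map _)
  have h3 : LinearMap.ker (f.submoduleMap C) = (C ⊓ LinearMap.ker f).submoduleOf C := by
    ext x
    simp [Submodule.submoduleOf, Subtype.ext_iff]
  rw [h3, (Submodule.submoduleOfEquivOfLe (inf_le_left : C ⊓ LinearMap.ker f ≤ C)).length_eq, ← len17_coe,
    ← len17_coe, ← len17_coe] at h2
  exact_mod_cast h2

/-- an irredundant generating set has at most `length` elements -/
theorem card_le_len17 {G : Finset M} {D : Submodule R M} (h : IsMinGenSet R (↑G : Set M) D) :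
    G.card ≤ len17 R D := by
  classical
  obtain ⟨h1, h2⟩ := h
  have key : ∀ s : Finset M, s ⊆ G → s.card ≤ len17 R (Submodule.span R (s : Set M)) := by
    intro s
    induction s using Finset.induction_on with
    | empty => intro _; simp
    | insert a s ha ih =>
      intro hs
      have hs' : s ⊆ G := (Finset.subset_insert a s).trans hs
      have haG : a ∈ G := hs (Finset.mem_insert_self a s)
      rw [Finset.card_insert_of_notMem ha]
      refine Nat.succ_le_of_lt (lt_of_le_of_lt (ih hs') (len17_lt ?_))
      refine lt_of_le_of_ne (Submodule.span_mono (by simp)) ?_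
      intro heq
      have ha1 : a ∈ Submodule.span R (s : Set M) := by
        rw [heq]; exact Submodule.subset_span (by simp)
      have ha2 : a ∈ Submodule.span R ((G.erase a : Finset M) : Set M) := by
        refine Submodule.span_mono ?_ ha1
        intro x hx
        have : x ≠ a := by rintro rfl; exact ha hx
        simpa [this] using hs' hx
      have h3 : Submodule.span R ((G.erase a : Finset M) : Set M) = D := by
        rw [← h1]
        refine le_antisymm (Submodule.span_mono (by simp)) (Submodule.span_le.2 ?_)
        intro x hx
        by_cases hxa : x = a
        · subst hxa; exact ha2
        · exact Submodule.subset_span (by simpa [hxa] using hx)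
      have h4 := h2 _ (by simp) h3
      have : a ∈ ((G.erase a : Finset M) : Set M) := by rw [h4]; exact haG
      simp at this
  have := key G subset_rfl
  rwa [h1] at this

theorem semisimple17 [Finite R] (D : Submodule R M)
    (hD : ∀ v ∈ D, ∀ r ∈ (⊥ : Ideal R).jacobson, r • v = 0) : IsSemisimpleModule R D := by
  have h : Module.IsTorsionBySet R D (Ring.jacobson R) := by
    rintro ⟨v, hv⟩ ⟨r, hr⟩
    have : r ∈ (⊥ : Ideal R).jacobson := by rw [Ideal.jacobson_bot]; exact hr
    exact Subtype.ext (hD v hv r this)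
  let _ := h.module
  exact (h.semilinearMap.isSemisimpleModule_iff_of_bijective Function.bijective_id).2
      inferInstance

theorem exists_gens17 [Finite R] : ∀ (k : ℕ) (D : Submodule R M),
    (∀ v ∈ D, ∀ r ∈ (⊥ : Ideal R).jacobson, r • v = 0) → len17 R D = k →
    ∃ G : Finset M, G.card = k ∧ IsMinGenSet R (↑G : Set M) D := by
  classical
  intro k
  induction k with
  | zero =>
    intro D hD h
    have : D = ⊥ := by
      by_contra hne
      have := len17_lt (bot_lt_iff_ne_bot.2 hne)
      omega
    subst this
    refine ⟨∅, by simp, by simp, ?_⟩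
    intro G' hG' _
    simpa using hG'
  | succ k ih =>
    intro D hD h
    have hne : D ≠ ⊥ := by
      rintro rfl
      rw [len17_bot] at h; omega
    obtain ⟨D', -, hcov⟩ := exists_le_covBy_of_lt (bot_lt_iff_ne_bot.2 hne)
    have hlen := len17_covBy hcov
    obtain ⟨G', hc, hs, hm⟩ := ih D' (fun v hv => hD v (hcov.le hv)) (by omega)
    have := semisimple17 D hD
    obtain ⟨S, hS⟩ := exists_isCompl (D'.submoduleOf D)
    have hSne : S ≠ ⊥ := by
      rintro rfl
      have h1 := hS.sup_eq_top
      rw [sup_bot_eq] at h1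
      exact hcov.lt.not_ge (Submodule.submoduleOf_eq_top.1 h1)
    obtain ⟨v, hvS, hv0⟩ := (Submodule.ne_bot_iff _).1 hSne
    have hdis : ∀ c : R, c • (v : M) ∈ D' → c • (v : M) = 0 := by
      intro c hcv
      have h1 : c • v ∈ D'.submoduleOf D ⊓ S := ⟨hcv, S.smul_mem c hvS⟩
      rw [hS.inf_eq_bot] at h1
      simpa using congrArg (Subtype.val) ((Submodule.mem_bot R).1 h1)
    have hv' : (v : M) ∉ D' := by
      intro hv'
      have := hdis 1 (by simpa using hv')
      apply hv0
      apply Subtype.ext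
      simpa using this
    have hvG : (v : M) ∉ G' := by
      intro h1; apply hv'; rw [← hs]; exact Submodule.subset_span h1
    refine ⟨insert (v : M) G', by rw [Finset.card_insert_of_notMem hvG, hc], ?_, ?_⟩
    · rw [Finset.coe_insert, Submodule.span_insert, hs]
      have hle : Submodule.span R {(v : M)} ⊔ D' ≤ D :=
        sup_le ((Submodule.span_singleton_le_iff_mem _ _).2 v.2) hcov.le
      refine (hcov.eq_or_eq le_sup_right hle).resolve_left ?_
      intro h1
      apply hv'
      rw [← h1]
      exact Submodule.mem_sup_left (Submodule.mem_span_singleton_self _)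
    · intro G'' hG'' hsp
      have hvin : (v : M) ∈ G'' := by
        by_contra hv2
        have : G'' ⊆ (G' : Set M) := by
          intro x hx
          have := hG'' hx
          rw [Finset.coe_insert] at this
          rcases this with rfl | h
          · exact absurd hx hv2
          · exact h
        have h1 := Submodule.span_mono (R := R) this
        rw [hsp, hs] at h1
        exact hcov.lt.not_ge h1
      have hsub : G'' ∩ G' ⊆ (G' : Set M) := Set.inter_subset_right
      have hG2 : G'' ⊆ insert (v : M) (G'' ∩ G') := by
        intro x hx
        have := hG'' hx
        rw [Finset.coe_insert] at this
        rcases this with rfl | h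
        · simp
        · exact Or.inr ⟨hx, h⟩
      have hsp2 : Submodule.span R (G'' ∩ G') = D' := by
        have hle : Submodule.span R (G'' ∩ G') ≤ D' := by
          rw [← hs]; exact Submodule.span_mono hsub
        refine le_antisymm hle ?_
        intro x hx
        have hxD := hcov.le hx
        rw [← hsp] at hxD
        have := Submodule.span_mono hG2 hxD
        rw [Submodule.mem_span_insert] at this
        obtain ⟨c, z, hz, rfl⟩ := this
        have h1 : c • (v : M) ∈ D' := by
          have := D'.sub_mem hx (hle hz)
          simpa using this
        rw [hdis c h1, zero_add]
        exact hz
      have h3 := hm _ hsub hsp2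
      refine Set.Subset.antisymm hG'' ?_
      rw [Finset.coe_insert]
      rintro x (rfl | hx)
      · exact hvin
      · rw [← h3] at hx
        exact hx.1

end general

section supp
variable {R : Type*} [CommRing R] [Finite R] {n u : ℕ} {σ : (Fin n → R) → Fin u → ℕ}

theorem le_suppOf17 (S : Set (Fin n → R)) {v : Fin n → R} (hv : v ∈ S) (i : Fin u) :
    σ v i ≤ suppOf σ S i :=
  le_csSup (Set.toFinite _).bddAbove ⟨v, hv, rfl⟩

theorem suppOf_mono17 {S T : Set (Fin n → R)} (hS : S.Nonempty) (h : S ⊆ T) (i : Fin u) :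
    suppOf σ S i ≤ suppOf σ T i :=
  csSup_le_csSup (Set.toFinite _).bddAbove (hS.image _) (Set.image_mono h)

theorem exists_suppOf17 {S : Set (Fin n → R)} (hS : S.Nonempty) (i : Fin u) :
    ∃ v ∈ S, σ v i = suppOf σ S i :=
  Nat.sSup_mem (hS.image (fun v => σ v i)) (Set.toFinite _).bddAbove

noncomputable def wS17 (σ : (Fin n → R) → Fin u → ℕ) (D : Submodule R (Fin n → R)) : ℕ :=
  ∑ i, suppOf σ (D : Set (Fin n → R)) i

theorem wS17_mono {D D' : Submodule R (Fin n → R)} (h : D ≤ D') : wS17 σ D ≤ wS17 σ D' :=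
  Finset.sum_le_sum fun i _ => suppOf_mono17 ⟨0, D.zero_mem⟩ h i

theorem descend17 (hσ : IsSupport σ) (hmod : IsModular σ) {D : Submodule R (Fin n → R)}
    (hD : D ≠ ⊥) : ∃ D', D' ⋖ D ∧ wS17 σ D' + 1 ≤ wS17 σ D := by
  obtain ⟨P1, P2, P3⟩ := hσ
  obtain ⟨x, hxD, hx0⟩ := (Submodule.ne_bot_iff _).1 hD
  have hex : ∃ i, σ x i ≠ 0 := by
    by_contra hcon
    push Not at hcon
    exact hx0 ((P1 x).1 (funext hcon))
  obtain ⟨i, hi⟩ := hex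
  have hne : (D : Set (Fin n → R)).Nonempty := ⟨0, D.zero_mem⟩
  obtain ⟨w, hwD, hw⟩ := exists_suppOf17 (σ := σ) hne i
  set m := suppOf σ (D : Set (Fin n → R)) i with hm
  have hm0 : 0 < m := lt_of_lt_of_le (Nat.pos_of_ne_zero hi) (le_suppOf17 _ hxD i)
  have hz : σ 0 i = 0 := by
    rw [(P1 0).2 rfl]; rfl
  let D' : Submodule R (Fin n → R) :=
    { carrier := {v | v ∈ D ∧ σ v i < m}
      zero_mem' := ⟨D.zero_mem, by rw [hz]; exact hm0⟩
      add_mem' := by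
        rintro a b ⟨ha, ha'⟩ ⟨hb, hb'⟩
        exact ⟨D.add_mem ha hb, lt_of_le_of_lt (P3 a b i) (max_lt ha' hb')⟩
      smul_mem' := by
        rintro c a ⟨ha, ha'⟩
        exact ⟨D.smul_mem c ha, lt_of_le_of_lt (P2 c a i) ha'⟩ }
  have hle : D' ≤ D := fun v hv => hv.1
  have key : ∀ a ∈ D, a ∉ D' → ∀ b ∈ D, ∃ c : R, b + c • a ∈ D' := by
    intro a ha ha' b hb
    have h1 : m ≤ σ a i := by
      by_contra hlt
      exact ha' ⟨ha, not_le.1 hlt⟩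
    by_cases hb' : b ∈ D'
    · exact ⟨0, by simpa using hb'⟩
    have h2 : m ≤ σ b i := by
      by_contra hlt
      exact hb' ⟨hb, not_le.1 hlt⟩
    have h3 : σ b i ≤ m := le_suppOf17 _ hb i
    obtain ⟨c, hc⟩ := hmod b a i (by omega) (by omega)
    exact ⟨c, D.add_mem hb (D.smul_mem c ha), by omega⟩
  refine ⟨D', ⟨lt_of_le_of_ne hle ?_, ?_⟩, ?_⟩
  · intro h
    rw [← h] at hwD
    have := hwD.2
    omega
  · intro E hE1 hE2
    obtain ⟨a, haE, haD'⟩ := SetLike.exists_of_lt hE1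
    apply hE2.not_ge
    intro b hb
    obtain ⟨c, hc⟩ := key a (hE2.le haE) haD' b hb
    have := E.sub_mem (hE1.le hc) (E.smul_mem c haE)
    simpa using this
  · refine Nat.succ_le_of_lt (Finset.sum_lt_sum (fun j _ => suppOf_mono17 ⟨0, D'.zero_mem⟩ hle j)
      ⟨i, Finset.mem_univ _, ?_⟩)
    obtain ⟨y, hyD, hy⟩ := exists_suppOf17 (σ := σ) (S := (D' : Set (Fin n → R)))
      ⟨0, D'.zero_mem⟩ i
    rw [← hy]
    exact hyD.2

theorem descend_to17 (hσ : IsSupport σ) (hmod : IsModular σ) (k d : ℕ) :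
    ∀ D : Submodule R (Fin n → R), len17 R D = k + d →
    ∃ D' ≤ D, len17 R D' = k ∧ wS17 σ D' + d ≤ wS17 σ D := by
  induction d with
  | zero => intro D h; exact ⟨D, le_rfl, h, le_rfl⟩
  | succ d ih =>
    intro D h
    have hne : D ≠ ⊥ := by
      rintro rfl
      rw [len17_bot] at h; omega
    obtain ⟨D1, hc, hw⟩ := descend17 hσ hmod hne
    have := len17_covBy hc
    obtain ⟨D', h1, h2, h3⟩ := ih D1 (by omega)
    exact ⟨D', h1.trans hc.le, h2, by omega⟩

/-- `min wt(C) + length(D) - 1 ≤ |σ(D)|` -/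
theorem lower17 (hσ : IsSupport σ) (hmod : IsModular σ) {D : Submodule R (Fin n → R)}
    (h : 1 ≤ len17 R D) : ∃ v ∈ D, v ≠ 0 ∧ (∑ i, σ v i) + len17 R D ≤ wS17 σ D + 1 := by
  obtain ⟨D', h1, h2, h3⟩ := descend_to17 hσ hmod 1 (len17 R D - 1) D (by omega)
  have hne : D' ≠ ⊥ := by
    rintro rfl
    rw [len17_bot] at h2; omega
  obtain ⟨v, hv, hv0⟩ := (Submodule.ne_bot_iff _).1 hne
  refine ⟨v, h1 hv, hv0, ?_⟩
  have : ∑ i, σ v i ≤ wS17 σ D' := Finset.sum_le_sum fun i _ => le_suppOf17 _ hv i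
  omega

end supp

section prod
variable {ℓ n : ℕ} {Rj : Fin ℓ → Type*} [∀ j, CommRing (Rj j)] [∀ j, Fintype (Rj j)]

theorem filt17 (C B : Submodule (∀ j, Rj j) (Fin n → ∀ j, Rj j)) (d : ℕ) :
    ∀ N : Submodule (∀ j, Rj j) (Fin n → ∀ j, Rj j), B ≤ N → N ≤ C →
    len17 (∀ j, Rj j) N = len17 (∀ j, Rj j) B + d →
    ∃ s : ∀ j, Finset (Fin n → Rj j), ∑ j, (s j).card ≤ d ∧
      (∀ j, (s j : Set (Fin n → Rj j)) ⊆ projCode C j) ∧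
      ∀ v ∈ N, ∃ b ∈ B, ∀ j, (fun i => v i j - b i j) ∈ Submodule.span (Rj j) (s j : Set _) := by
  classical
  induction d with
  | zero =>
    intro N hB hN h
    have : B = N := by
      by_contra hne
      have := len17_lt (lt_of_le_of_ne hB hne)
      omega
    subst this
    refine ⟨fun _ => ∅, by simp, by simp, fun v hv => ⟨v, hv, fun j => ?_⟩⟩
    simp only [sub_self]
    exact Submodule.zero_mem _
  | succ d ih =>
    intro N hB hN h
    have hlt : B < N := by
      refine lt_of_le_of_ne hB ?_
      rintro rfl
      omega
    obtain ⟨N', hBN', hcov⟩ := exists_le_covBy_of_lt hlt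
    have hl := len17_covBy hcov
    obtain ⟨s, hs1, hs2, hs3⟩ := ih N' hBN' (hcov.le.trans hN) (by omega)
    obtain ⟨v, hvN, hvN'⟩ := SetLike.exists_of_lt hcov.lt
    have hex : ∃ j, (Pi.single j 1 : ∀ j, Rj j) • v ∉ N' := by
      by_contra hcon
      push Not at hcon
      apply hvN'
      have : v = ∑ j, (Pi.single j 1 : ∀ j, Rj j) • v := by
        rw [← Finset.sum_smul, Finset.univ_sum_single (fun j => (1 : Rj j))]
        exact (one_smul _ v).symm
      rw [this]
      exact N'.sum_mem fun j _ => hcon j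
    obtain ⟨k, hk⟩ := hex
    set w := (Pi.single k 1 : ∀ j, Rj j) • v with hw
    have hwN : w ∈ N := N.smul_mem _ hvN
    have hspan : N' ⊔ Submodule.span _ {w} = N := by
      refine (hcov.eq_or_eq le_sup_left (sup_le hcov.le
        ((Submodule.span_singleton_le_iff_mem _ _).2 hwN))).resolve_left ?_
      intro h1
      apply hk
      rw [← h1]
      exact Submodule.mem_sup_right (Submodule.mem_span_singleton_self _)
    have hwk : ∀ j, j ≠ k → ∀ i, w i j = 0 := by
      intro j hj i
      simp [hw, Pi.single_eq_of_ne hj]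
    refine ⟨Function.update s k (insert (fun i => w i k) (s k)), ?_, ?_, ?_⟩
    · have h1 : ∀ j, (Function.update s k (insert (fun i => w i k) (s k)) j).card
          ≤ (s j).card + if j = k then 1 else 0 := by
        intro j
        by_cases hj : j = k
        · subst hj
          simpa using Finset.card_insert_le _ _
        · simp [hj]
      refine (Finset.sum_le_sum fun j _ => h1 j).trans ?_
      rw [Finset.sum_add_distrib]
      simpa using hs1
    · intro j
      by_cases hj : j = k
      · subst hj
        simp only [Function.update_self, Finset.coe_insert]
        refine Set.insert_subset ?_ (hs2 j)
        exact Submodule.subset_span ⟨w, hN hwN, rfl⟩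
      · simpa [hj] using hs2 j
    · intro x hx
      rw [← hspan] at hx
      obtain ⟨y, hy, z, hz, rfl⟩ := Submodule.mem_sup.1 hx
      obtain ⟨c, rfl⟩ := Submodule.mem_span_singleton.1 hz
      obtain ⟨b, hb, hb'⟩ := hs3 y hy
      refine ⟨b, hb, fun j => ?_⟩
      by_cases hj : j = k
      · subst hj
        simp only [Function.update_self, Finset.coe_insert]
        rw [Submodule.mem_span_insert]
        refine ⟨c j, _, hb' j, ?_⟩
        funext i
        simp
        ring
      · simp only [Function.update_of_ne hj]
        convert hb' j using 1
        funext i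
        simp [hwk j hj i]

theorem Mnum_le17 [∀ j, IsLocalRing (Rj j)] (C B : Submodule (∀ j, Rj j) (Fin n → ∀ j, Rj j))
    (hB : B = (⊥ : Ideal (∀ j, Rj j)).jacobson • C) :
    Mnum C + len17 (∀ j, Rj j) B ≤ len17 (∀ j, Rj j) C := by
  classical
  have hBC : B ≤ C := by rw [hB]; exact Submodule.smul_le_right
  have hlen : len17 (∀ j, Rj j) B ≤ len17 (∀ j, Rj j) C := by
    rcases hBC.eq_or_lt with h | h
    · rw [h]
    · exact (len17_lt h).le
  obtain ⟨s, h1, h2, h3⟩ := filt17 C B (len17 (∀ j, Rj j) C - len17 (∀ j, Rj j) B) C hBC le_rfl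
    (by omega)
  have h4 : Mnum C ≤ ∑ j, (s j).card := by
    refine Finset.sum_le_sum fun j _ => Nat.sInf_le ⟨s j, rfl, ?_⟩
    refine le_antisymm (Submodule.span_le.2 (h2 j)) ?_
    have hJ : ∀ r ∈ (⊥ : Ideal (∀ j, Rj j)).jacobson, r j ∈ (⊥ : Ideal (Rj j)).jacobson := by
      intro r hr
      rw [Ideal.mem_jacobson_bot] at hr ⊢
      intro y
      have := (hr (Pi.single j y)).map (Pi.evalRingHom Rj j)
      simpa using this
    refine Submodule.le_of_le_smul_of_le_jacobson_bot (I := (⊥ : Ideal (Rj j)).jacobson)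
      (Submodule.FG.of_finite) le_rfl ?_
    refine Submodule.span_le.2 ?_
    rintro w ⟨v, hv, rfl⟩
    obtain ⟨b, hb, hb'⟩ := h3 v hv
    have hbj : (fun i => b i j) ∈ (⊥ : Ideal (Rj j)).jacobson • projCode C j := by
      rw [hB] at hb
      refine Submodule.smul_induction_on (p := fun b : Fin n → ∀ j, Rj j =>
        (fun i => b i j) ∈ (⊥ : Ideal (Rj j)).jacobson • projCode C j) hb ?_ ?_
      · intro r hr c hc
        exact Submodule.smul_mem_smul (hJ r hr) (Submodule.subset_span ⟨c, hc, rfl⟩ :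
          (fun i => c i j) ∈ projCode C j)
      · intro x y hx hy
        exact Submodule.add_mem _ hx hy
    have := Submodule.add_mem_sup (hb' j) hbj
    rw [SetLike.mem_coe]
    convert this using 1
    funext i
    simp
  omega

theorem Mnum_pos17 (C : Submodule (∀ j, Rj j) (Fin n → ∀ j, Rj j)) (hC : C ≠ ⊥) :
    1 ≤ Mnum C := by
  obtain ⟨v, hv, hv0⟩ := (Submodule.ne_bot_iff _).1 hC
  have : ∃ i j, v i j ≠ 0 := by
    by_contra hcon
    push Not at hcon
    exact hv0 (funext fun i => funext fun j => hcon i j)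
  obtain ⟨i, j, hij⟩ := this
  have h1 : 1 ≤ mu (Rj j) (projCode C j) := by
    obtain ⟨s, hs⟩ := (Submodule.FG.of_finite : (projCode C j).FG)
    have hmem := Nat.sInf_mem (s := {k | ∃ s : Finset (Fin n → Rj j), s.card = k ∧
      Submodule.span (Rj j) (s : Set (Fin n → Rj j)) = projCode C j}) ⟨_, s, rfl, hs⟩
    obtain ⟨t, ht, ht'⟩ := hmem
    change t.card = mu (Rj j) (projCode C j) at ht
    rw [← ht]
    refine Nat.one_le_iff_ne_zero.2 fun h0 => ?_
    rw [Finset.card_eq_zero] at h0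
    subst h0
    have hvj : (fun i => v i j) ∈ projCode C j := Submodule.subset_span ⟨v, hv, rfl⟩
    rw [← ht'] at hvj
    simp at hvj
    exact hij (congrFun hvj i)
  exact h1.trans (Finset.single_le_sum (f := fun j => mu (Rj j) (projCode C j))
    (fun _ _ => Nat.zero_le _) (Finset.mem_univ j))

theorem Mnum_le_soc17 [∀ j, IsLocalRing (Rj j)]
    (C : Submodule (∀ j, Rj j) (Fin n → ∀ j, Rj j))
    (hcase : (∀ v ∈ C, ∀ r ∈ (⊥ : Ideal (∀ j, Rj j)).jacobson,
        r • v = (0 : Fin n → ∀ j, Rj j)) ∨ (∀ j, IsPrincipalIdealRing (Rj j))) :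
    Mnum C ≤ len17 (∀ j, Rj j) (socJ C) := by
  have key := Mnum_le17 C _ rfl
  rcases hcase with h | h
  · have hs : socJ C = C := by
      refine inf_eq_left.2 ?_
      intro v hv
      simp only [Submodule.mem_iInf]
      intro r hr
      exact h v hv r hr
    rw [hs]
    omega
  · obtain ⟨t, ht⟩ := (IsPrincipalIdealRing.principal (⊥ : Ideal (∀ j, Rj j)).jacobson)
    have hmap := len17_map C (LinearMap.lsmul (∀ j, Rj j) (Fin n → ∀ j, Rj j) t)
    have e1 : (⊥ : Ideal (∀ j, Rj j)).jacobson • C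
        = C.map (LinearMap.lsmul (∀ j, Rj j) (Fin n → ∀ j, Rj j) t) := by
      rw [ht]
      change Ideal.span {t} • C = _
      rw [Submodule.ideal_span_singleton_smul]
      rfl
    have e2 : C ⊓ LinearMap.ker (LinearMap.lsmul (∀ j, Rj j) (Fin n → ∀ j, Rj j) t)
        ≤ socJ C := by
      refine inf_le_inf_left _ ?_
      intro v hv
      simp only [Submodule.mem_iInf]
      intro r hr
      rw [ht] at hr
      obtain ⟨a, rfl⟩ := Submodule.mem_span_singleton.1 hr
      have hv' : t • v = 0 := hv
      change (a • t) • v = 0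
      rw [smul_assoc, hv', smul_zero]
    have e3 : len17 (∀ j, Rj j)
        (C ⊓ LinearMap.ker (LinearMap.lsmul (∀ j, Rj j) (Fin n → ∀ j, Rj j) t))
        ≤ len17 (∀ j, Rj j) (socJ C) := by
      rcases e2.eq_or_lt with h | h
      · rw [h]
      · exact (len17_lt h).le
    rw [e1] at key
    omega

end prod

/-- Corollary `singleton`: over a product `R = R_1 × … × R_ℓ` of finite
local rings with Jacobson radical `J`, for a modular support `σ` and a nonzero code
`C ⊆ R^n` with either `C ⊆ 0:_{R^n} J` or each `R_j` a finite chain ring: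
`min wt(C) + r − 1 ≤ d_r(C) ≤ |σ(0:_{R^n} J)| − M(C) + r` for `1 ≤ r ≤ M(C)`;
in particular `min wt(C) ≤ |σ(0:_{R^n} J)| − M(C) + 1`. -/
theorem stmt_17 {ℓ n u : ℕ} {Rj : Fin ℓ → Type*} [∀ j, CommRing (Rj j)] [∀ j, Fintype (Rj j)]
    [∀ j, IsLocalRing (Rj j)]
    (σ : (Fin n → ∀ j, Rj j) → Fin u → ℕ) (hσ : IsSupport σ) (hmod : IsModular σ)
    (C : Submodule (∀ j, Rj j) (Fin n → ∀ j, Rj j)) (hC : C ≠ ⊥)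
    (hcase : (∀ v ∈ C, ∀ r ∈ (⊥ : Ideal (∀ j, Rj j)).jacobson,
        r • v = (0 : Fin n → ∀ j, Rj j)) ∨ (∀ j, IsPrincipalIdealRing (Rj j))) :
    (∀ r : ℕ, 1 ≤ r → r ≤ Mnum C →
      ((sInf {w | ∃ v ∈ C, v ≠ (0 : Fin n → ∀ j, Rj j) ∧ w = ∑ i, σ v i} : ℤ) + r - 1
          ≤ (dGW σ r C : ℤ)) ∧
      ((dGW σ r C : ℤ) ≤
        (∑ i, suppOf σ (socJ (⊤ : Submodule (∀ j, Rj j) (Fin n → ∀ j, Rj j)) :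
            Set (Fin n → ∀ j, Rj j)) i : ℤ) - (Mnum C : ℤ) + r)) ∧
    ((sInf {w | ∃ v ∈ C, v ≠ (0 : Fin n → ∀ j, Rj j) ∧ w = ∑ i, σ v i} : ℤ) ≤
      (∑ i, suppOf σ (socJ (⊤ : Submodule (∀ j, Rj j) (Fin n → ∀ j, Rj j)) :
          Set (Fin n → ∀ j, Rj j)) i : ℤ) - (Mnum C : ℤ) + 1) := by
  classical
  have hM := Mnum_le_soc17 C hcase
  have hMpos := Mnum_pos17 C hC
  have hsocC : socJ C ≤ C := inf_le_left
  have hsoc : socJ C ≤ socJ ⊤ := inf_le_inf_right _ le_top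
  have hann : ∀ v ∈ socJ C, ∀ r ∈ (⊥ : Ideal (∀ j, Rj j)).jacobson, r • v = 0 := by
    intro v hv r hr
    have h1 : v ∈ ⨅ r ∈ (⊥ : Ideal (∀ j, Rj j)).jacobson, LinearMap.ker
        (LinearMap.lsmul (∀ j, Rj j) (Fin n → ∀ j, Rj j) r) := hv.2
    simp only [Submodule.mem_iInf] at h1
    exact h1 r hr
  have hlow : ∀ D ≤ C, 1 ≤ len17 (∀ j, Rj j) D →
      (sInf {w | ∃ v ∈ C, v ≠ (0 : Fin n → ∀ j, Rj j) ∧ w = ∑ i, σ v i} : ℤ)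
        + len17 (∀ j, Rj j) D ≤ wS17 σ D + 1 := by
    intro D hD h1
    obtain ⟨v, hv, hv0, hw⟩ := lower17 hσ hmod h1
    have h2 : (sInf {w | ∃ v ∈ C, v ≠ (0 : Fin n → ∀ j, Rj j) ∧ w = ∑ i, σ v i} : ℤ)
        ≤ ∑ i, (σ v i : ℤ) := by
      refine csInf_le ⟨0, ?_⟩ ⟨v, hD hv, hv0, by push_cast; rfl⟩
      rintro w ⟨v, -, -, rfl⟩
      positivity
    have h3 : (∑ i, (σ v i : ℤ)) + len17 (∀ j, Rj j) D ≤ wS17 σ D + 1 := by exact_mod_cast hw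
    omega
  have hw0 : wS17 σ (socJ C) ≤ wS17 σ (socJ ⊤) := wS17_mono hsoc
  have hcast : (∑ i, suppOf σ (socJ (⊤ : Submodule (∀ j, Rj j) (Fin n → ∀ j, Rj j)) :
            Set (Fin n → ∀ j, Rj j)) i : ℤ) = (wS17 σ (socJ ⊤) : ℤ) := by
    simp [wS17]
  rw [hcast]
  refine ⟨fun r hr1 hrM => ?_, ?_⟩
  · obtain ⟨D, hDle, hDlen, hDw⟩ := descend_to17 hσ hmod r (len17 (∀ j, Rj j) (socJ C) - r)
      (socJ C) (by omega)
    obtain ⟨G, hGc, hG⟩ := exists_gens17 r D (fun v hv => hann v (hDle hv)) hDlen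
    have hmemD : wS17 σ D ∈ {w | ∃ j, r ≤ j ∧ ∃ D : Submodule (∀ j, Rj j) (Fin n → ∀ j, Rj j),
        memS j C D ∧ w = ∑ i, suppOf σ (D : Set (Fin n → ∀ j, Rj j)) i} :=
      ⟨r, le_rfl, D, ⟨hDle.trans hsocC, G, hGc, hG⟩, rfl⟩
    constructor
    · obtain ⟨j, hj, E, ⟨hEC, G', hG'c, hG'⟩, hE⟩ := Nat.sInf_mem ⟨_, hmemD⟩
      have h1 := card_le_len17 hG'
      have h2 := hlow E hEC (by omega)
      have h3 : dGW σ r C = wS17 σ E := hE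
      rw [h3]
      omega
    · have h1 : dGW σ r C ≤ wS17 σ D := Nat.sInf_le hmemD
      omega
  · have h1 := hlow (socJ C) hsocC (by omega)
    omega
end

section
/- Let R be a finite commutative ring with Jacobson radical J, let σ : R^n → ℕ^u be a modular support, let 0 ≠ C ⊆ R^n be an R-linear code, and let K be a field with S = K[x_1,…,x_u]. For v ∈ R^n \ {0} set m_v := x_1^{σ(v)_1} ⋯ x_u^{σ(v)_u} ∈ S, and for a nonzero code D let I_D ⊆ S be the ideal generated by { m_v : v ∈ D \ {0} }. Then I_C = I_{0:_C J} = the ideal generated by { m_v : v ∈ Min(C) }, and { m_v : v ∈ Min(C) } is a minimal system of generators of I_C; in particular, for every v ∈ Min(C), the monomial m_v does not lie in the ideal generated by { m_w : w ∈ Min(C), σ(w) ≠ σ(v) }. -/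
/-- The monomial `m_v = x^{σ(v)}` associated to a vector. -/
noncomputable def monOf {R : Type*} [CommRing R] {n u : ℕ} (K : Type*) [Field K]
    (σ : (Fin n → R) → Fin u → ℕ) (v : Fin n → R) : MvPolynomial (Fin u) K :=
  MvPolynomial.monomial (Finsupp.equivFunOnFinite.symm (σ v)) 1

/-- The monomial ideal `I_D` associated to a set of vectors `D`. -/
noncomputable def idealOf {R : Type*} [CommRing R] {n u : ℕ} (K : Type*) [Field K]
    (σ : (Fin n → R) → Fin u → ℕ) (D : Set (Fin n → R)) : Ideal (MvPolynomial (Fin u) K) :=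
  Ideal.span {p | ∃ v ∈ D, v ≠ 0 ∧ p = monOf K σ v}

theorem span_le_aux {R : Type*} [CommRing R] {n u : ℕ} (K : Type*) [Field K]
    (σ : (Fin n → R) → Fin u → ℕ) (v w : Fin n → R) (h : σ w ≤ σ v)
    (I : Ideal (MvPolynomial (Fin u) K)) (hw : monOf K σ w ∈ I) : monOf K σ v ∈ I := by
  refine Ideal.mem_of_dvd I ?_ hw
  unfold monOf
  rw [MvPolynomial.monomial_dvd_monomial]
  exact ⟨Or.inr (fun i => h i), dvd_rfl⟩

theorem soc_aux {R : Type*} [CommRing R] [Finite R] {n : ℕ} (v : Fin n → R) (hv : v ≠ 0) :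
    ∃ r : R, r • v ≠ 0 ∧ ∀ s ∈ (⊥ : Ideal R).jacobson, s • (r • v) = 0 := by
  classical
  obtain ⟨k, hk⟩ := IsArtinianRing.isNilpotent_jacobson_bot (R := R)
  have hex : ∃ k, ∀ r ∈ (⊥ : Ideal R).jacobson ^ k, r • v = 0 := by
    refine ⟨k, fun r hr => ?_⟩
    rw [hk] at hr
    have : r = 0 := by simpa using hr
    simp [this]
  have hs := Nat.find_spec hex
  have hm := fun m => Nat.find_min hex (m := m)
  rcases hf : Nat.find hex with _ | m
  · rw [hf] at hs
    exact absurd (by simpa using hs 1 (by simp)) hv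
  · have h1 := hm m (by omega)
    push Not at h1
    obtain ⟨r, hr, hrv⟩ := h1
    refine ⟨r, hrv, fun s hsJ => ?_⟩
    rw [smul_smul]
    apply hs
    rw [hf, pow_succ, mul_comm s r]
    exact Ideal.mul_mem_mul hr hsJ

theorem min_aux {M : Type*} [Zero M] {u : ℕ} (σ : M → Fin u → ℕ) (S : Set M) (v : M)
    (hv : v ∈ S) (h0 : v ≠ 0) : ∃ w ∈ MinSet σ S, σ w ≤ σ v := by
  obtain ⟨w, ⟨hw, hw0, hwv⟩, hmin⟩ := (InvImage.wf σ (wellFounded_lt (α := Fin u → ℕ))).has_min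
    {w | w ∈ S ∧ w ≠ 0 ∧ σ w ≤ σ v} ⟨v, hv, h0, le_rfl⟩
  refine ⟨w, ⟨hw, hw0, fun x hx hx0 hxw => ?_⟩, hwv⟩
  by_contra hne
  exact hmin x ⟨hx, hx0, hxw.trans hwv⟩ (lt_of_le_of_ne hxw hne)

/-- Proposition `prop:minimal`: for a modular support `σ` over a finite
commutative ring `R` with Jacobson radical `J` and a nonzero code `C ⊆ R^n`:
`I_C = I_{0:_C J}`, `I_C` is generated by the monomials of the minimal codewords of `C`,
and these form a minimal system of generators of `I_C` (no `m_v`, `v ∈ Min(C)`, lies in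
the ideal generated by the `m_w` with `w ∈ Min(C)`, `σ(w) ≠ σ(v)`). -/
theorem stmt_18 {R : Type*} [CommRing R] [Fintype R] [Nontrivial R] {n u : ℕ}
    (σ : (Fin n → R) → Fin u → ℕ) (hσ : IsSupport σ) (hmod : IsModular σ)
    (C : Submodule R (Fin n → R)) (hC : C ≠ ⊥)
    (K : Type*) [Field K] :
    idealOf K σ (C : Set (Fin n → R)) =
      idealOf K σ {v | v ∈ C ∧ ∀ r ∈ (⊥ : Ideal R).jacobson, r • v = (0 : Fin n → R)} ∧
    idealOf K σ (C : Set (Fin n → R)) =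
      Ideal.span {p | ∃ v ∈ MinSet σ (C : Set (Fin n → R)), p = monOf K σ v} ∧
    ∀ v ∈ MinSet σ (C : Set (Fin n → R)),
      monOf K σ v ∉
        Ideal.span {p | ∃ w ∈ MinSet σ (C : Set (Fin n → R)), σ w ≠ σ v ∧ p = monOf K σ w} := by
  refine ⟨le_antisymm ?_ ?_, le_antisymm ?_ ?_, ?_⟩
  · refine Ideal.span_le.2 ?_
    rintro p ⟨v, hv, hv0, rfl⟩
    obtain ⟨r, hr, hs⟩ := soc_aux v hv0
    exact span_le_aux K σ v (r • v) (hσ.2.1 r v) _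
      (Ideal.subset_span ⟨r • v, ⟨C.smul_mem r hv, hs⟩, hr, rfl⟩)
  · refine Ideal.span_mono ?_
    rintro p ⟨v, hv, hv0, rfl⟩
    exact ⟨v, hv.1, hv0, rfl⟩
  · refine Ideal.span_le.2 ?_
    rintro p ⟨v, hv, hv0, rfl⟩
    obtain ⟨w, hw, hwv⟩ := min_aux σ (C : Set (Fin n → R)) v hv hv0
    exact span_le_aux K σ v w hwv _ (Ideal.subset_span ⟨w, hw, rfl⟩)
  · refine Ideal.span_mono ?_
    rintro p ⟨v, hv, rfl⟩
    exact ⟨v, hv.1, hv.2.1, rfl⟩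
  · intro v hv hmem
    have hset : {p | ∃ w ∈ MinSet σ (C : Set (Fin n → R)), σ w ≠ σ v ∧ p = monOf K σ w} =
        (fun s => MvPolynomial.monomial s (1 : K)) '' {s | ∃ w ∈ MinSet σ (C : Set (Fin n → R)),
          σ w ≠ σ v ∧ s = Finsupp.equivFunOnFinite.symm (σ w)} := by
      ext p
      constructor
      · rintro ⟨w, hw, hne, rfl⟩
        exact ⟨_, ⟨w, hw, hne, rfl⟩, rfl⟩
      · rintro ⟨_, ⟨w, hw, hne, rfl⟩, rfl⟩
        exact ⟨w, hw, hne, rfl⟩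
    rw [hset, MvPolynomial.mem_ideal_span_monomial_image] at hmem
    obtain ⟨_, ⟨w, hw, hne, rfl⟩, hle⟩ := hmem (Finsupp.equivFunOnFinite.symm (σ v))
      (by simp [monOf])
    exact hne (hv.2.2 w hw.1 hw.2.1 (fun i => hle i))
end

section
/- Let q be a prime power and 1 ≤ k ≤ n. Let 𝒰 be the set of all k-dimensional F_q-subspaces of F_q^n and let 𝒰' ⊆ 𝒰 be the set of those k-dimensional subspaces C that are generated by their codewords of maximal Hamming support (that is, C equals the span of { v ∈ C \ {0} : no w ∈ C has σ^H(w) ⊋ σ^H(v) }). Then, as integers, |𝒰'| · (q^n − 1)(q^k − q^{k−1} − 1) ≥ ( (q−1)^n (q^k − 1) − (q^n − 1) q^{k−1} ) · |𝒰|; equivalently (when q^k − q^{k−1} − 1 > 0), the proportion of k-dimensional codes generated by their maximal codewords is at least ((q−1)^n (q^k − 1) − (q^n − 1) q^{k−1}) / ((q^n − 1)(q^k − q^{k−1} − 1)). -/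
theorem aux_trans {F V : Type*} [Field F] [AddCommGroup V] [Module F V] [FiniteDimensional F V]
    (v w : V) (hv : v ≠ 0) (hw : w ≠ 0) : ∃ g : V ≃ₗ[F] V, g v = w := by
  let e := (LinearEquiv.toSpanNonzeroSingleton F V v hv).symm.trans
    (LinearEquiv.toSpanNonzeroSingleton F V w hw)
  obtain ⟨g, hg⟩ := Submodule.exists_linearEquiv_restrict_eq e
  refine ⟨g, ?_⟩
  have hvm : v ∈ Submodule.span F {v} := Submodule.mem_span_singleton_self v
  have h1 : g v = e ⟨v, hvm⟩ := (hg ⟨v, hvm⟩).symm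
  have h2 : (LinearEquiv.toSpanNonzeroSingleton F V v hv).symm ⟨v, hvm⟩ = 1 := by
    rw [LinearEquiv.symm_apply_eq]
    ext
    simp
  rw [h1]
  simp [e, h2]

open Classical in
theorem aux_count {F V : Type*} [Field F] [AddCommGroup V] [Module F V] [FiniteDimensional F V]
    [Fintype (Submodule F V)] (k : ℕ) (v w : V) (hv : v ≠ 0) (hw : w ≠ 0) :
    (Finset.univ.filter (fun C : Submodule F V => Module.finrank F C = k ∧ v ∈ C)).card =
    (Finset.univ.filter (fun C : Submodule F V => Module.finrank F C = k ∧ w ∈ C)).card := by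
  obtain ⟨g, hg⟩ := aux_trans (F := F) v w hv hw
  refine Finset.card_equiv (Submodule.orderIsoMapComap g).toEquiv ?_
  intro C
  have h : g v ∈ Submodule.map (g : V →ₗ[F] V) C ↔ v ∈ C := by
    constructor
    · rintro ⟨x, hx, hxe⟩
      rwa [← g.injective hxe]
    · intro h
      exact ⟨v, h, rfl⟩
  simp only [Finset.mem_filter, Finset.mem_univ, true_and]
  change _ ↔ Module.finrank F (Submodule.map (g : V →ₗ[F] V) C) = k ∧
    w ∈ Submodule.map (g : V →ₗ[F] V) C
  rw [← hg, h, LinearEquiv.finrank_map_eq]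

open Classical in
theorem aux_main {F : Type*} [Field F] [Fintype F] {n k : ℕ} [Fintype (Submodule F (Fin n → F))]
    (A : Finset (Fin n → F)) (hA : (0 : Fin n → F) ∉ A) (hn : 1 ≤ n) :
    (∑ C ∈ Finset.univ.filter (fun C : Submodule F (Fin n → F) => Module.finrank F C = k), (A.filter (· ∈ C)).card)
      * (Fintype.card F ^ n - 1) = A.card * ((Fintype.card F ^ k - 1) *
      (Finset.univ.filter (fun C : Submodule F (Fin n → F) => Module.finrank F C = k)).card) := by
  have key : ∀ B : Finset (Fin n → F),
      (∑ C ∈ Finset.univ.filter (fun C : Submodule F (Fin n → F) => Module.finrank F C = k), (B.filter (· ∈ C)).card) =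
      ∑ v ∈ B, (Finset.univ.filter
        (fun C : Submodule F (Fin n → F) => Module.finrank F C = k ∧ v ∈ C)).card := by
    intro B
    simp_rw [← Finset.filter_filter]
    exact Finset.sum_card_bipartiteAbove_eq_sum_card_bipartiteBelow (fun C v => v ∈ C)
  have hone : (1 : Fin n → F) ≠ 0 := by
    intro h
    have := congrFun h ⟨0, hn⟩
    simp at this
  have key2 : ∀ B : Finset (Fin n → F), (0 : Fin n → F) ∉ B →
      (∑ C ∈ Finset.univ.filter (fun C : Submodule F (Fin n → F) => Module.finrank F C = k), (B.filter (· ∈ C)).card) =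
      B.card * (Finset.univ.filter
        (fun C : Submodule F (Fin n → F) => Module.finrank F C = k ∧ (1 : Fin n → F) ∈ C)).card := by
    intro B hB
    rw [key, Finset.sum_const_nat]
    intro v hv
    exact aux_count k v 1 (fun h => hB (h ▸ hv)) hone
  have h2 := key2 (Finset.univ.erase 0) (by simp)
  have h3 : (∑ C ∈ Finset.univ.filter (fun C : Submodule F (Fin n → F) => Module.finrank F C = k),
      ((Finset.univ.erase (0 : Fin n → F)).filter (· ∈ C)).card) =
      (Finset.univ.filter (fun C : Submodule F (Fin n → F) => Module.finrank F C = k)).card *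
        (Fintype.card F ^ k - 1) := by
    rw [Finset.sum_const_nat]
    intro C hC
    have hC' : Module.finrank F C = k := by simpa using hC
    rw [Finset.filter_erase, Finset.card_erase_of_mem (by simp), ← Fintype.card_subtype]
    have := Module.card_eq_pow_finrank (K := F) (V := C)
    rw [hC'] at this
    rw [← this]
  rw [h3] at h2
  rw [key2 A hA]
  have h4 : (Finset.univ.erase (0 : Fin n → F)).card = Fintype.card F ^ n - 1 := by
    rw [Finset.card_erase_of_mem (by simp)]
    simp
  rw [h4] at h2
  rw [mul_comm (Fintype.card F ^ k - 1), h2]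
  ring

/-- Proposition `prop:estimate`: let `q = |F|`, `1 ≤ k ≤ n`, `𝒰` the set
of `k`-dimensional subspaces of `F^n` and `𝒰'` those generated by their codewords of
maximal Hamming support. Then, as integers,
`|𝒰'|·(q^n − 1)(q^k − q^{k−1} − 1) ≥ ((q−1)^n (q^k − 1) − (q^n − 1) q^{k−1})·|𝒰|`. -/
theorem stmt_19 {F : Type*} [Field F] [Fintype F] {n k : ℕ} (hk1 : 1 ≤ k) (hkn : k ≤ n)
    (q : ℤ) (hq : q = Fintype.card F)
    (U U' : Set (Submodule F (Fin n → F)))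
    (hU : U = {C : Submodule F (Fin n → F) | Module.finrank F ↥C = k})
    (hU' : U' = {C | C ∈ U ∧ C = Submodule.span F
      {v : Fin n → F | v ∈ C ∧ v ≠ 0 ∧
        ¬∃ w, w ∈ C ∧ {i | v i ≠ 0} ⊂ {i | w i ≠ 0}}}) :
    ((q - 1) ^ n * (q ^ k - 1) - (q ^ n - 1) * q ^ (k - 1)) * (U.ncard : ℤ) ≤
      (U'.ncard : ℤ) * ((q ^ n - 1) * (q ^ k - q ^ (k - 1) - 1)) := by
  classical
  haveI : Fintype (Submodule F (Fin n → F)) := Fintype.ofFinite _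
  have hn : 1 ≤ n := hk1.trans hkn
  set A : Finset (Fin n → F) := Finset.univ.filter (fun v => ∀ i, v i ≠ 0) with hAdef
  have hA0 : (0 : Fin n → F) ∉ A := by
    simp only [hAdef, Finset.mem_filter, not_and]
    intro _ h
    exact h ⟨0, hn⟩ rfl
  have hAcard : A.card = (Fintype.card F - 1) ^ n := by
    have : A = Fintype.piFinset (fun _ : Fin n => Finset.univ.erase (0 : F)) := by
      ext v
      simp [hAdef]
    rw [this, Fintype.card_piFinset]
    simp
  have hq1 : 1 ≤ Fintype.card F := Fintype.card_pos
  have hmain := aux_main (k := k) A hA0 hn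
  set UF : Finset (Submodule F (Fin n → F)) :=
    Finset.univ.filter (fun C : Submodule F (Fin n → F) => Module.finrank F C = k) with hUF
  have hUc : U = (UF : Set (Submodule F (Fin n → F))) := by
    rw [hU]
    ext C
    simp [hUF]
  set UF' : Finset (Submodule F (Fin n → F)) := UF.filter (fun C => C ∈ U') with hUF'
  have hUc' : U' = (UF' : Set (Submodule F (Fin n → F))) := by
    ext C
    simp only [hUF', Finset.coe_filter, Set.mem_setOf_eq]
    constructor
    · intro h
      refine ⟨?_, h⟩
      have h' := h
      rw [hU'] at h'
      have := h'.1
      rw [hUc] at this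
      exact this
    · exact fun h => h.2
  have e1 : U.ncard = UF.card := by rw [hUc, Set.ncard_coe_finset]
  have e2 : U'.ncard = UF'.card := by
    rw [← Set.ncard_coe_finset, ← hUc']
  have hcard : ∀ C : Submodule F (Fin n → F), (Finset.univ.filter (· ∈ C)).card =
      Fintype.card F ^ Module.finrank F C := by
    intro C
    rw [← Fintype.card_subtype, ← Module.card_eq_pow_finrank (K := F) (V := C)]
  have hb1 : ∀ C ∈ UF, (A.filter (· ∈ C)).card ≤ Fintype.card F ^ k - 1 := by
    intro C hC
    have hC' : Module.finrank F C = k := by simpa [hUF] using hC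
    rw [← hC', ← hcard C, ← Finset.card_erase_of_mem (a := (0 : Fin n → F)) (by simp)]
    apply Finset.card_le_card
    intro v hv
    rw [Finset.mem_filter] at hv
    simp only [Finset.mem_erase, Finset.mem_filter, Finset.mem_univ, true_and]
    exact ⟨fun h => hA0 (h ▸ hv.1), hv.2⟩
  have hb2 : ∀ C ∈ UF, C ∉ U' → (A.filter (· ∈ C)).card ≤ Fintype.card F ^ (k - 1) := by
    intro C hC hCU
    have hC' : Module.finrank F C = k := by simpa [hUF] using hC
    set D := Submodule.span F {v : Fin n → F | v ∈ C ∧ v ≠ 0 ∧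
        ¬∃ w, w ∈ C ∧ {i | v i ≠ 0} ⊂ {i | w i ≠ 0}} with hD
    have hDC : D ≤ C := Submodule.span_le.2 (fun v hv => hv.1)
    have hne : D ≠ C := by
      intro h
      apply hCU
      rw [hU']
      refine ⟨?_, h.symm⟩
      rw [hUc]
      exact hC
    have hlt := Submodule.finrank_lt_finrank_of_lt (lt_of_le_of_ne hDC hne)
    have hle : Module.finrank F D ≤ k - 1 := by omega
    refine le_trans ?_ (Nat.pow_le_pow_right hq1 hle)
    rw [← hcard D]
    apply Finset.card_le_card
    intro v hv
    rw [Finset.mem_filter] at hv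
    simp only [Finset.mem_filter, Finset.mem_univ, true_and]
    refine Submodule.subset_span ⟨hv.2, fun h => hA0 (h ▸ hv.1), ?_⟩
    rintro ⟨w, -, hw⟩
    apply hw.2
    intro i _
    have := hv.1
    simp only [hAdef, Finset.mem_filter, Finset.mem_univ, true_and] at this
    exact this i
  have hS : (∑ C ∈ UF, (A.filter (· ∈ C)).card) ≤
      UF'.card * (Fintype.card F ^ k - 1) +
      (UF.filter (fun C => ¬ C ∈ U')).card * Fintype.card F ^ (k - 1) := by
    rw [← Finset.sum_filter_add_sum_filter_not UF (fun C => C ∈ U')]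
    apply add_le_add
    · refine (Finset.sum_le_card_nsmul _ _ (Fintype.card F ^ k - 1) ?_).trans (by simp [hUF'])
      intro C hC
      exact hb1 C (Finset.mem_filter.1 hC).1
    · refine (Finset.sum_le_card_nsmul _ _ (Fintype.card F ^ (k - 1)) ?_).trans (by simp)
      intro C hC
      exact hb2 C (Finset.mem_filter.1 hC).1 (Finset.mem_filter.1 hC).2
  have hsplit : UF'.card + (UF.filter (fun C => ¬ C ∈ U')).card = UF.card :=
    Finset.card_filter_add_card_filter_not _
  rw [hAcard] at hmain
  rw [e1, e2]
  generalize (∑ C ∈ UF, (A.filter (· ∈ C)).card) = S at *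
  generalize (UF.filter (fun C => ¬ C ∈ U')).card = c at *
  have p1 : 1 ≤ Fintype.card F ^ n := Nat.one_le_pow _ _ hq1
  have p2 : 1 ≤ Fintype.card F ^ k := Nat.one_le_pow _ _ hq1
  have hmainZ : (S : ℤ) * (q ^ n - 1) = (q - 1) ^ n * ((q ^ k - 1) * UF.card) := by
    rw [hq]
    have := congrArg (Nat.cast : ℕ → ℤ) hmain
    push_cast [Nat.cast_sub p1, Nat.cast_sub p2, Nat.cast_sub hq1] at this
    exact this
  have hSZ : (S : ℤ) ≤ UF'.card * (q ^ k - 1) + c * q ^ (k - 1) := by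
    rw [hq]
    have := Int.ofNat_le.2 hS
    push_cast [Nat.cast_sub p2] at this
    exact this
  have hsZ : (UF'.card : ℤ) + c = UF.card := by exact_mod_cast hsplit
  have hpos : 0 ≤ q ^ n - 1 := by
    rw [hq]
    have : (1 : ℤ) ≤ (Fintype.card F : ℤ) ^ n := by exact_mod_cast p1
    linarith
  have := mul_le_mul_of_nonneg_right hSZ hpos
  rw [hmainZ] at this
  rw [← hsZ] at this ⊢
  linarith
end
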